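/- Let a < b be real numbers and n ≥ 1 a natural number. Let μ be a finite signed measure on ℝ concentrated on (a,b] with distribution function F(x) = μ((a,x]), and define I₀ = F and I_k(x) = ∫_a^x I_{k−1}(t) dt for k ≥ 1. Assume F(b) = 0 and I_k(b) = 0 for all k = 1, …, n. Then for every function f : [a,b] → ℝ that is continuous on [a,b] and (n+1)-times continuously differentiable on (a,b) with all derivatives up to order n+1 integrable, ∫_{[a,b]} f dμ = (−1)^{n+1} ∫_a^b I_n(x) f^{(n+1)}(x) dx. -/

import Mathlib

open MeasureTheory Set

/-- Integral of `f` with respect to a finite signed measure `μ`,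
defined via the Jordan decomposition `μ = μ⁺ - μ⁻`. -/
noncomputable def sintegral (μ : SignedMeasure ℝ) (f : ℝ → ℝ) : ℝ :=
  (∫ x, f x ∂μ.toJordanDecomposition.posPart) - ∫ x, f x ∂μ.toJordanDecomposition.negPart

/-- Integral of `f` over a set `s` with respect to a finite signed measure `μ`. -/
noncomputable def sintegralOn (μ : SignedMeasure ℝ) (s : Set ℝ) (f : ℝ → ℝ) : ℝ :=
  (∫ x in s, f x ∂μ.toJordanDecomposition.posPart) - ∫ x in s, f x ∂μ.toJordanDecomposition.negPart

/-- A signed measure `μ` is concentrated on `s` if `|μ|(sᶜ) = 0`. -/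
def ConcentratedOn (μ : SignedMeasure ℝ) (s : Set ℝ) : Prop :=
  μ.totalVariation sᶜ = 0

/-- Iterated integrals based at `a`: `I₀ = F`, `I_{k+1}(x) = ∫_a^x I_k(t) dt`. -/
noncomputable def iterInt (a : ℝ) (F : ℝ → ℝ) : ℕ → ℝ → ℝ
  | 0 => F
  | k + 1 => fun x => ∫ t in a..x, iterInt a F k t

/-- `f` is `n`-convex on `(a,b)` (`n ≥ 1`): it is `(n-1)`-times differentiable on `(a,b)`
and its `(n-1)`-st derivative is convex on `(a,b)`. -/
def NConvexOn (n : ℕ) (a b : ℝ) (f : ℝ → ℝ) : Prop :=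
  ContDiffOn ℝ ((n - 1 : ℕ) : ℕ∞) f (Ioo a b) ∧
  ConvexOn ℝ (Ioo a b) (iteratedDerivWithin (n - 1) f (Ioo a b))

/-- Integration by parts against a measure `ν` with density `g` on `(a, b]`. -/
theorem setIntegral_mul_eq_sub_intervalIntegral {a b : ℝ} (hab : a ≤ b) (ν : Measure ℝ)
    [SFinite ν] {g f f' : ℝ → ℝ} (hg : IntegrableOn g (Ioc a b) ν)
    (hf : ContinuousOn f (Icc a b)) (hf' : ∀ x ∈ Ioo a b, HasDerivAt f (f' x) x)
    (hint : IntervalIntegrable f' volume a b) :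
    ∫ y in Ioc a b, g y * f y ∂ν =
      f b * (∫ y in Ioc a b, g y ∂ν) - ∫ x in a..b, (∫ y in Ioc a x, g y ∂ν) * f' x := by
  have hf'i : IntegrableOn f' (Ioc a b) volume :=
    (intervalIntegrable_iff_integrableOn_Ioc_of_le hab).1 hint
  have hT : MeasurableSet {p : ℝ × ℝ | p.1 ≤ p.2} := measurableSet_le measurable_fst measurable_snd
  have hprod : Integrable ({p : ℝ × ℝ | p.1 ≤ p.2}.indicator fun p => g p.1 * f' p.2)
      ((ν.restrict (Ioc a b)).prod (volume.restrict (Ioc a b))) :=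
    (Integrable.mul_prod hg hf'i).indicator hT
  have hleft : ∀ y ∈ Ioc a b, (∫ x in Ioc a b,
      {p : ℝ × ℝ | p.1 ≤ p.2}.indicator (fun p => g p.1 * f' p.2) (y, x)) =
        f b * g y - g y * f y := by
    intro y hy
    have hFTC : ∫ x in y..b, f' x = f b - f y :=
      intervalIntegral.integral_eq_sub_of_hasDerivAt_of_le hy.2
        (hf.mono (Icc_subset_Icc_left hy.1.le))
        (fun x hx => hf' x ⟨hy.1.trans hx.1, hx.2⟩)
        (hint.mono_set (by
          rw [uIcc_of_le hy.2, uIcc_of_le hab]; exact Icc_subset_Icc_left hy.1.le))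
    have hind : (fun x => {p : ℝ × ℝ | p.1 ≤ p.2}.indicator (fun p => g p.1 * f' p.2) (y, x)) =
        (Ici y).indicator fun x => g y * f' x := by
      ext x; simp [indicator]
    have hset : Ioc a b ∩ Ici y = Icc y b := by
      ext x; simp only [mem_inter_iff, mem_Ioc, mem_Ici, mem_Icc]
      exact ⟨fun h => ⟨h.2, h.1.2⟩, fun h => ⟨⟨hy.1.trans_le h.1, h.2⟩, h.1⟩⟩
    rw [hind, setIntegral_indicator measurableSet_Ici, hset, integral_Icc_eq_integral_Ioc,
      integral_const_mul, ← intervalIntegral.integral_of_le hy.2, hFTC]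
    ring
  have hright : ∀ x ∈ Ioc a b, (∫ y in Ioc a b,
      {p : ℝ × ℝ | p.1 ≤ p.2}.indicator (fun p => g p.1 * f' p.2) (y, x) ∂ν) =
        (∫ y in Ioc a x, g y ∂ν) * f' x := by
    intro x hx
    have hind : (fun y => {p : ℝ × ℝ | p.1 ≤ p.2}.indicator (fun p => g p.1 * f' p.2) (y, x)) =
        (Iic x).indicator fun y => g y * f' x := by
      ext y; simp [indicator]
    have hset : Ioc a b ∩ Iic x = Ioc a x := by
      ext y; simp only [mem_inter_iff, mem_Ioc, mem_Iic]
      exact ⟨fun h => ⟨h.1.1, h.2⟩, fun h => ⟨⟨h.1, h.2.trans hx.2⟩, h.2⟩⟩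
    rw [hind, setIntegral_indicator measurableSet_Iic, hset, integral_mul_const]
  have hgf : IntegrableOn (fun y => g y * f y) (Ioc a b) ν := by
    obtain ⟨C, hC⟩ := isCompact_Icc.exists_bound_of_continuousOn hf
    refine hg.mul_bdd (c := C)
      ((hf.mono Ioc_subset_Icc_self).aestronglyMeasurable measurableSet_Ioc) ?_
    exact (ae_restrict_iff' measurableSet_Ioc).2
      (.of_forall fun y hy => hC y (Ioc_subset_Icc_self hy))
  have hswap := integral_integral_swap
    (f := fun y x => {p : ℝ × ℝ | p.1 ≤ p.2}.indicator (fun p => g p.1 * f' p.2) (y, x)) hprod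
  rw [setIntegral_congr_fun measurableSet_Ioc hleft,
    setIntegral_congr_fun measurableSet_Ioc hright,
    integral_sub (hg.const_mul _) hgf, integral_const_mul,
    ← intervalIntegral.integral_of_le (μ := volume) hab] at hswap
  linarith

/-- The value of a signed measure is the difference of the masses of its Jordan parts. -/
theorem signedMeasure_apply_eq_sub (μ : SignedMeasure ℝ) {s : Set ℝ} (hs : MeasurableSet s) :
    μ s = μ.toJordanDecomposition.posPart.real s - μ.toJordanDecomposition.negPart.real s := by
  conv_lhs => rw [← μ.toSignedMeasure_toJordanDecomposition]
  exact Measure.toSignedMeasure_sub_apply hs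

theorem intervalIntegrable_measureReal_Ioc (ν : Measure ℝ) [IsFiniteMeasure ν] (a b c : ℝ) :
    IntervalIntegrable (fun x => ν.real (Ioc a x)) volume b c :=
  Monotone.intervalIntegrable fun _ _ h => measureReal_mono (Ioc_subset_Ioc_right h)

theorem intervalIntegrable_iterInt {a b : ℝ} {F : ℝ → ℝ}
    (hF : IntervalIntegrable F volume a b) (k : ℕ) :
    IntervalIntegrable (iterInt a F k) volume a b := by
  induction k with
  | zero => exact hF
  | succ k ih =>
    exact (intervalIntegral.continuousOn_primitive_interval' ih left_mem_uIcc).intervalIntegrable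

/-- Integration by parts for the iterated integrals of `F`. -/
theorem integral_iterInt_mul {a b : ℝ} (hab : a ≤ b) {F : ℝ → ℝ}
    (hF : IntervalIntegrable F volume a b) (k : ℕ) {f f' : ℝ → ℝ}
    (hf : ContinuousOn f (Icc a b)) (hf' : ∀ x ∈ Ioo a b, HasDerivAt f (f' x) x)
    (hint : IntervalIntegrable f' volume a b) :
    ∫ x in a..b, iterInt a F k x * f x =
      f b * iterInt a F (k + 1) b - ∫ x in a..b, iterInt a F (k + 1) x * f' x := by
  have h := setIntegral_mul_eq_sub_intervalIntegral hab volume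
    ((intervalIntegrable_iff_integrableOn_Ioc_of_le hab).1 (intervalIntegrable_iterInt hF k))
    hf hf' hint
  have hcongr : ∫ x in a..b, iterInt a F (k + 1) x * f' x =
      ∫ x in a..b, (∫ y in Ioc a x, iterInt a F k y) * f' x := by
    refine intervalIntegral.integral_congr fun x hx => ?_
    rw [uIcc_of_le hab] at hx
    simp only [iterInt, intervalIntegral.integral_of_le hx.1]
  rw [hcongr, intervalIntegral.integral_of_le hab, h]
  simp only [iterInt, intervalIntegral.integral_of_le hab]

/-- Integration by parts against a finite measure that does not charge `a`. -/
theorem setIntegral_Icc_eq_sub {a b : ℝ} (hab : a ≤ b) (ν : Measure ℝ) [IsFiniteMeasure ν]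
    (hν : ν {a} = 0) {f f' : ℝ → ℝ}
    (hf : ContinuousOn f (Icc a b)) (hf' : ∀ x ∈ Ioo a b, HasDerivAt f (f' x) x)
    (hint : IntervalIntegrable f' volume a b) :
    ∫ y in Icc a b, f y ∂ν =
      f b * ν.real (Ioc a b) - ∫ x in a..b, ν.real (Ioc a x) * f' x := by
  have h := setIntegral_mul_eq_sub_intervalIntegral hab ν (g := fun _ => 1)
    integrableOn_const hf hf' hint
  rw [integral_Icc_eq_integral_Ioc' hν]
  simpa using h

theorem intervalIntegrable_measureReal_Ioc_mul {a b : ℝ} (hab : a ≤ b) (ν : Measure ℝ)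
    [IsFiniteMeasure ν] {f : ℝ → ℝ} (hf : IntervalIntegrable f volume a b) :
    IntervalIntegrable (fun x => ν.real (Ioc a x) * f x) volume a b := by
  rw [intervalIntegrable_iff_integrableOn_Ioc_of_le hab] at hf ⊢
  refine Integrable.bdd_mul (c := ν.real univ) hf ?_ (.of_forall fun x => ?_)
  · exact (intervalIntegrable_measureReal_Ioc ν a a b).1.aestronglyMeasurable
  · rw [Real.norm_of_nonneg measureReal_nonneg]
    exact measureReal_mono (subset_univ _)

/-- **Formula (2.15).** If `F(b) = 0` and `I_k(b) = 0` for `k = 1,…,n`, then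
`∫_{[a,b]} f dμ = (−1)^{n+1} ∫_a^b I_n(x) f^{(n+1)}(x) dx`, where `fd j` denotes
the `j`-th derivative of `f` (`fd 0 = f`). -/
theorem statement5 (a b : ℝ) (hab : a < b) (n : ℕ) (hn : 1 ≤ n)
    (μ : SignedMeasure ℝ) (hμ : ConcentratedOn μ (Ioc a b))
    (F : ℝ → ℝ) (hF : ∀ x, F x = μ (Ioc a x))
    (hFb : F b = 0) (hIb : ∀ k, 1 ≤ k → k ≤ n → iterInt a F k b = 0) :
    ∀ (f : ℝ → ℝ) (fd : ℕ → ℝ → ℝ), fd 0 = f →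
      ContinuousOn f (Icc a b) →
      (∀ j ≤ n, ∀ x ∈ Ioo a b, HasDerivAt (fd j) (fd (j + 1) x) x) →
      (∀ j ≤ n, ContinuousOn (fd j) (Icc a b)) →
      ContinuousOn (fd (n + 1)) (Ioo a b) →
      (∀ j ≤ n + 1, IntervalIntegrable (fd j) volume a b) →
      sintegralOn μ (Icc a b) f =
        (-1 : ℝ) ^ (n + 1) * ∫ x in a..b, iterInt a F n x * fd (n + 1) x := by
  rintro f fd rfl hf hder hcont _ hint
  set P := μ.toJordanDecomposition.posPart
  set N := μ.toJordanDecomposition.negPart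
  have hFPN : F = fun x => P.real (Ioc a x) - N.real (Ioc a x) :=
    funext fun x => (hF x).trans (signedMeasure_apply_eq_sub μ measurableSet_Ioc)
  have hFint : IntervalIntegrable F volume a b := by
    rw [hFPN]
    exact (intervalIntegrable_measureReal_Ioc P a a b).sub
      (intervalIntegrable_measureReal_Ioc N a a b)
  have ha : P {a} + N {a} = 0 :=
    measure_mono_null (μ := P + N) (singleton_subset_iff.2 (by simp)) hμ
  obtain ⟨hPa, hNa⟩ := add_eq_zero.1 ha
  have hbase : sintegralOn μ (Icc a b) (fd 0) = -∫ x in a..b, iterInt a F 0 x * fd 1 x := by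
    have h1 := hint 1 (by omega)
    have hb : P.real (Ioc a b) - N.real (Ioc a b) = 0 := by rw [← hFb, hFPN]
    have hsplit : ∫ x in a..b, iterInt a F 0 x * fd 1 x =
        (∫ x in a..b, P.real (Ioc a x) * fd 1 x) - ∫ x in a..b, N.real (Ioc a x) * fd 1 x := by
      rw [← intervalIntegral.integral_sub
        (intervalIntegrable_measureReal_Ioc_mul hab.le P h1)
        (intervalIntegrable_measureReal_Ioc_mul hab.le N h1)]
      simp only [iterInt, hFPN, sub_mul]
    rw [sintegralOn, setIntegral_Icc_eq_sub hab.le P hPa hf (hder 0 n.zero_le) h1,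
      setIntegral_Icc_eq_sub hab.le N hNa hf (hder 0 n.zero_le) h1, hsplit]
    linear_combination fd 0 b * hb
  have hstep : ∀ k ≤ n, sintegralOn μ (Icc a b) (fd 0) =
      (-1 : ℝ) ^ (k + 1) * ∫ x in a..b, iterInt a F k x * fd (k + 1) x := by
    intro k
    induction k with
    | zero => intro _; simpa using hbase
    | succ k ih =>
      intro hk
      rw [ih (by omega), integral_iterInt_mul hab.le hFint k (hcont (k + 1) hk)
        (hder (k + 1) hk) (hint (k + 2) (by omega)), hIb (k + 1) (by omega) hk]
      ring
  exact hstep n le_rfl
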